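/- Let 1 ≤ k ≤ n−1. Then e_{n−k} · I_{n,k} ⊆ J_{n,k}; in particular, for each 1 ≤ i ≤ n one has x_i^k · e_{n−k} ∈ J_{n,k}. Consequently, multiplication by e_{n−k} followed by projection induces a well-defined ℚ-linear map φ : R_{n,k} → S_{n,k} which is homogeneous of degree n−k and S_n-equivariant. -/

import Mathlib

open scoped BigOperators

namespace PackedWords

/-- An ordered set partition of `[n] = {1, …, n}` with `k` blocks: a sequence
`B_1 | ⋯ | B_k` of nonempty pairwise disjoint subsets of `[n]` whose union is `[n]`. -/
structure OSP (n k : ℕ) where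
  blocks : Fin k → Finset ℕ
  subset_range : ∀ j, blocks j ⊆ Finset.Icc 1 n
  blocks_nonempty : ∀ j, (blocks j).Nonempty
  blocks_disjoint : ∀ j₁ j₂ : Fin k, j₁ ≠ j₂ → Disjoint (blocks j₁) (blocks j₂)
  cover : ∀ i ∈ Finset.Icc 1 n, ∃ j, i ∈ blocks j

/-- Common generalization of the coinversion code (`b = 0`) and the boosted
coinversion code (`b = 1`).  Position `p : Fin n` corresponds to the letter
`i = p + 1` of `[n]`.  If `i ∈ B_j` (blocks indexed `0, …, k-1`, so `j` here is
the paper's `j - 1`), then `c_i = #{ℓ > j : min B_ℓ > i}` if `i = min B_j`, and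
`c_i = #{ℓ > j : min B_ℓ > i} + (j - 1) + b` (in the paper's 1-indexing) otherwise. -/
noncomputable def codeAux {n k : ℕ} (b : ℕ) (σ : OSP n k) (p : Fin n) : ℕ :=
  if h : ∃ j, ((p : ℕ) + 1) ∈ σ.blocks j then
    (Finset.univ.filter fun ℓ : Fin k =>
        h.choose < ℓ ∧ ∀ x ∈ σ.blocks ℓ, (p : ℕ) + 1 < x).card
      + (if ∀ x ∈ σ.blocks h.choose, (p : ℕ) + 1 ≤ x then 0 else (h.choose : ℕ) + b)
  else 0

/-- The coinversion code of an ordered set partition. -/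
noncomputable def code {n k : ℕ} (σ : OSP n k) : Fin n → ℕ := codeAux 0 σ

/-- The boosted coinversion code of an ordered set partition. -/
noncomputable def bcode {n k : ℕ} (σ : OSP n k) : Fin n → ℕ := codeAux 1 σ

/-- The skip sequence of a finite set `S = {s_1 < s_2 < ⋯} ⊆ ℕ`:
`γ_i = i - j + 1` if `i = s_j ∈ S`, and `γ_i = 0` otherwise. -/
def skip (S : Finset ℕ) (i : ℕ) : ℕ :=
  if i ∈ S then i - (S.filter (· < i)).card else 0

/-- The reverse skip sequence `γ(S)* = (γ_n, …, γ_1)` of `S ⊆ [n]`, read at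
position `p : Fin n` (so position `p` carries `γ_{n - p}` in 1-indexed terms). -/
def revSkipAt (n : ℕ) (S : Finset ℕ) (p : Fin n) : ℕ := skip S (n - (p : ℕ))

/-- For `T ⊆ [n-1]` with skip sequence `γ = γ(T)`, the length-`n` sequence
`(γ_{n-1}, …, γ_i, d, γ_{i-1}, …, γ_1)` obtained from the reverse skip sequence of `T`
by inserting `d` in position `n - i + 1` (1-indexed), read at position `p : Fin n`. -/
def insSeq (n i d : ℕ) (T : Finset ℕ) (p : Fin n) : ℕ :=
  if (p : ℕ) + 1 ≤ n - i then skip T (n - ((p : ℕ) + 1))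
  else if (p : ℕ) + 1 = n - i + 1 then d
  else skip T (n - ((p : ℕ) + 1) + 1)

/-- `Packedk n k w`: `w` is a packed word of length `n` on the alphabet of positive
integers (whenever `i + 1` appears as a letter, so does `i`) in which each of the
letters `1, 2, …, k` appears. -/
def Packedk (n k : ℕ) (w : Fin n → ℕ) : Prop :=
  (∀ p, 1 ≤ w p) ∧ (∀ i, 1 ≤ i → (∃ p, w p = i + 1) → ∃ p, w p = i) ∧
    (∀ j, 1 ≤ j → j ≤ k → ∃ p, w p = j)

/-- The elementary symmetric polynomial of degree `a` in the variables `X j`, `j ∈ s`. -/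
noncomputable def esymmOn (n : ℕ) (s : Finset (Fin n)) (a : ℕ) : MvPolynomial (Fin n) ℚ :=
  ∑ t ∈ s.powersetCard a, ∏ j ∈ t, MvPolynomial.X j

/-- The complete homogeneous symmetric polynomial of degree `b` evaluated at
`α 1, α 2, …, α d`. -/
noncomputable def hval (b d : ℕ) (α : ℕ → ℚ) : ℚ :=
  ∑ m : Sym (Fin d) b, ((m : Multiset (Fin d)).map fun j => α ((j : ℕ) + 1)).prod

/-- The locus `X_{n,k} ⊆ ℚ^n` of points `(α_{w_1}, …, α_{w_n})` for `w ∈ W_{n,k}`. -/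
def packedPoints (n k : ℕ) (α : ℕ → ℚ) : Set (Fin n → ℚ) :=
  {x | ∃ w : Fin n → ℕ, Packedk n k w ∧ x = fun p => α (w p)}

/-- The ideal `J_n = ⟨x_i^d e_{n-r}^{(i)} : 1 ≤ i ≤ n, 1 ≤ r ≤ d⟩`. -/
noncomputable def Jn (n : ℕ) : Ideal (MvPolynomial (Fin n) ℚ) :=
  Ideal.span {g | ∃ (i : Fin n) (r d : ℕ), 1 ≤ r ∧ r ≤ d ∧
    g = MvPolynomial.X i ^ d * esymmOn n {i}ᶜ (n - r)}

/-- The ideal `J_{n,k} = J_n + ⟨e_n, e_{n-1}, …, e_{n-k+1}⟩`. -/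
noncomputable def Jnk (n k : ℕ) : Ideal (MvPolynomial (Fin n) ℚ) :=
  Jn n ⊔ Ideal.span {g | ∃ j : ℕ, n - k + 1 ≤ j ∧ j ≤ n ∧ g = esymmOn n Finset.univ j}

/-- The Haglund–Rhoades–Shimozono ideal
`I_{n,k} = ⟨x_1^k, …, x_n^k, e_n, e_{n-1}, …, e_{n-k+1}⟩`. -/
noncomputable def Ink (n k : ℕ) : Ideal (MvPolynomial (Fin n) ℚ) :=
  Ideal.span ({g | ∃ i : Fin n, g = MvPolynomial.X i ^ k} ∪
    {g | ∃ j : ℕ, n - k + 1 ≤ j ∧ j ≤ n ∧ g = esymmOn n Finset.univ j})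

/-- `T(X)`: the ideal generated by the top-degree homogeneous components `τ(f)` of
all nonzero polynomials `f` vanishing on `X`. -/
noncomputable def gradedIdeal (n : ℕ) (X : Set (Fin n → ℚ)) : Ideal (MvPolynomial (Fin n) ℚ) :=
  Ideal.span {g | ∃ f : MvPolynomial (Fin n) ℚ, f ≠ 0 ∧
    (∀ x ∈ X, MvPolynomial.eval x f = 0) ∧
    g = MvPolynomial.homogeneousComponent f.totalDegree f}

/-- The degree-`d` homogeneous component of the quotient `ℚ[x_1, …, x_n]/I`,
namely the image of the space of homogeneous polynomials of degree `d`. -/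
noncomputable def quotComp (n : ℕ) (I : Ideal (MvPolynomial (Fin n) ℚ)) (d : ℕ) :
    Submodule ℚ (MvPolynomial (Fin n) ℚ ⧸ I) :=
  Submodule.map (Ideal.Quotient.mkₐ ℚ I).toLinearMap
    (MvPolynomial.homogeneousSubmodule (Fin n) ℚ d)

/-- The degree-`(d - a)` homogeneous component of `ℚ[x_1, …, x_n]/I`, interpreted as
zero when `d - a < 0` (degree shift by `a`). -/
noncomputable def quotCompShift (n : ℕ) (I : Ideal (MvPolynomial (Fin n) ℚ)) (d a : ℕ) :
    Submodule ℚ (MvPolynomial (Fin n) ℚ ⧸ I) :=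
  if a ≤ d then quotComp n I (d - a) else ⊥

lemma packedk_comp {n k : ℕ} {w : Fin n → ℕ} (σ : Equiv.Perm (Fin n)) (h : Packedk n k w) :
    Packedk n k (w ∘ σ) := by
  obtain ⟨h1, h2, h3⟩ := h
  refine ⟨fun p => h1 _, fun i hi hex => ?_, fun j hj hjk => ?_⟩
  · obtain ⟨q, hq⟩ := h2 i hi (by obtain ⟨p, hp⟩ := hex; exact ⟨σ p, hp⟩)
    exact ⟨σ.symm q, by simpa using hq⟩
  · obtain ⟨q, hq⟩ := h3 j hj hjk
    exact ⟨σ.symm q, by simpa using hq⟩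

/-- The left action of a permutation `σ ∈ S_n` on packed words, sending `w` to
`w ∘ σ⁻¹` (the permutation action on positions). -/
noncomputable def wordPerm (n k : ℕ) (σ : Equiv.Perm (Fin n)) :
    {w : Fin n → ℕ // Packedk n k w} ≃ {w : Fin n → ℕ // Packedk n k w} where
  toFun w := ⟨w.1 ∘ σ.symm, packedk_comp σ.symm w.2⟩
  invFun w := ⟨w.1 ∘ σ, packedk_comp σ w.2⟩
  left_inv w := Subtype.ext (funext fun p => by simp)
  right_inv w := Subtype.ext (funext fun p => by simp)

/-- Splitting off the variable `x_i` from an elementary symmetric polynomial. -/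
lemma esymmOn_univ_succ (n a : ℕ) (i : Fin n) :
    esymmOn n Finset.univ (a + 1) =
      esymmOn n {i}ᶜ (a + 1) + MvPolynomial.X i * esymmOn n {i}ᶜ a := by
  have hi : i ∉ ({i}ᶜ : Finset (Fin n)) := by simp
  have hu : (Finset.univ : Finset (Fin n)) = insert i {i}ᶜ := by
    ext j; simp
  have h_not_mem {b : ℕ} {t : Finset (Fin n)} (ht : t ∈ Finset.powersetCard b {i}ᶜ) : i ∉ t :=
    fun h => hi ((Finset.mem_powersetCard.mp ht).1 h)
  unfold esymmOn
  rw [hu, Finset.powersetCard_succ_insert hi, Finset.sum_union, Finset.sum_image, Finset.mul_sum]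
  · refine congrArg _ (Finset.sum_congr rfl fun t ht => ?_)
    exact Finset.prod_insert (h_not_mem ht)
  · intro t ht u hu' h
    rw [← Finset.erase_insert (h_not_mem ht), ← Finset.erase_insert (h_not_mem hu'), h]
  · refine Finset.disjoint_left.mpr fun t ht ht' => h_not_mem ht ?_
    obtain ⟨u, -, rfl⟩ := Finset.mem_image.mp ht'
    exact Finset.mem_insert_self i u

lemma X_pow_mul_esymmOn_compl_mem_Jn {n : ℕ} (i : Fin n) {r d : ℕ} (hr : 1 ≤ r) (hrd : r ≤ d) :
    MvPolynomial.X i ^ d * esymmOn n {i}ᶜ (n - r) ∈ Jn n :=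
  Ideal.subset_span ⟨i, r, d, hr, hrd, rfl⟩

lemma X_pow_mul_esymmOn_univ_mem_Jn {n k : ℕ} (hk : 1 ≤ k) (hkn : k < n) (i : Fin n) :
    MvPolynomial.X i ^ k * esymmOn n Finset.univ (n - k) ∈ Jn n := by
  obtain ⟨a, rfl⟩ := Nat.exists_eq_add_of_lt hkn
  have h₁ := X_pow_mul_esymmOn_compl_mem_Jn i hk le_rfl
  have h₂ := X_pow_mul_esymmOn_compl_mem_Jn i (Nat.le_add_left 1 k) le_rfl
  rw [show k + a + 1 - k = a + 1 by omega] at h₁ ⊢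
  rw [show k + a + 1 - (k + 1) = a by omega, pow_succ, mul_assoc] at h₂
  rw [esymmOn_univ_succ _ a i, mul_add]
  exact add_mem h₁ h₂

lemma esymmOn_isHomogeneous (n : ℕ) (s : Finset (Fin n)) (a : ℕ) :
    (esymmOn n s a).IsHomogeneous a := by
  refine MvPolynomial.IsHomogeneous.sum _ _ _ fun t ht => ?_
  rw [← (Finset.mem_powersetCard.mp ht).2, Finset.card_eq_sum_ones]
  exact MvPolynomial.IsHomogeneous.prod _ _ _ fun j _ => MvPolynomial.isHomogeneous_X ℚ j

lemma rename_esymmOn_univ (n a : ℕ) (σ : Equiv.Perm (Fin n)) :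
    MvPolynomial.rename σ (esymmOn n Finset.univ a) = esymmOn n Finset.univ a :=
  MvPolynomial.rename_esymm (Fin n) ℚ a σ

lemma esymmOn_mul_mem_Jnk {n k : ℕ} (hk : 1 ≤ k) (hkn : k < n)
    {f : MvPolynomial (Fin n) ℚ} (hf : f ∈ Ink n k) :
    esymmOn n Finset.univ (n - k) * f ∈ Jnk n k := by
  suffices h : Ink n k ≤ Submodule.comap
      (LinearMap.mulLeft (MvPolynomial (Fin n) ℚ) (esymmOn n Finset.univ (n - k))) (Jnk n k) from
    h hf
  refine Ideal.span_le.mpr ?_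
  rintro _ (⟨i, rfl⟩ | hj)
  · have h := X_pow_mul_esymmOn_univ_mem_Jn hk hkn i
    rw [mul_comm] at h
    exact Ideal.mem_sup_left h
  · exact Ideal.mul_mem_left _ _ (Ideal.mem_sup_right (Ideal.subset_span hj))

/-- for `1 ≤ k ≤ n - 1` we have `e_{n-k} · I_{n,k} ⊆ J_{n,k}`; in particular
`x_i^k · e_{n-k} ∈ J_{n,k}` for each `i`.  Consequently multiplication by `e_{n-k}` followed
by projection induces a well-defined `ℚ`-linear map `φ : R_{n,k} → S_{n,k}` which is
homogeneous of degree `n - k` and `S_n`-equivariant. -/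
theorem mul_esymm_map (n k : ℕ) (hk : 1 ≤ k) (hkn : k ≤ n - 1) :
    (∀ f ∈ Ink n k, esymmOn n (Finset.univ : Finset (Fin n)) (n - k) * f ∈ Jnk n k) ∧
    (∀ i : Fin n,
      MvPolynomial.X i ^ k * esymmOn n (Finset.univ : Finset (Fin n)) (n - k) ∈ Jnk n k) ∧
    ∃ φ : (MvPolynomial (Fin n) ℚ ⧸ Ink n k) →ₗ[ℚ] (MvPolynomial (Fin n) ℚ ⧸ Jnk n k),
      (∀ f : MvPolynomial (Fin n) ℚ,
        φ (Ideal.Quotient.mk (Ink n k) f) =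
          Ideal.Quotient.mk (Jnk n k)
            (esymmOn n (Finset.univ : Finset (Fin n)) (n - k) * f)) ∧
      (∀ (d : ℕ) (f : MvPolynomial (Fin n) ℚ),
        f ∈ MvPolynomial.homogeneousSubmodule (Fin n) ℚ d →
          φ (Ideal.Quotient.mk (Ink n k) f) ∈ quotComp n (Jnk n k) (d + (n - k))) ∧
      (∀ (σ : Equiv.Perm (Fin n)) (f : MvPolynomial (Fin n) ℚ),
        φ (Ideal.Quotient.mk (Ink n k) (MvPolynomial.rename σ f)) =
          Ideal.Quotient.mk (Jnk n k)
            (MvPolynomial.rename σ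
              (esymmOn n (Finset.univ : Finset (Fin n)) (n - k) * f))) := by
  have hlt : k < n := by omega
  refine ⟨fun f hf => esymmOn_mul_mem_Jnk hk hlt hf,
    fun i => Ideal.mem_sup_left (X_pow_mul_esymmOn_univ_mem_Jn hk hlt i),
    (Submodule.mapQ (Ink n k) (Jnk n k)
      (LinearMap.mulLeft (MvPolynomial (Fin n) ℚ) (esymmOn n Finset.univ (n - k)))
      fun f hf => esymmOn_mul_mem_Jnk hk hlt hf).restrictScalars ℚ,
    fun f => rfl, fun d f hf => ?_, fun σ f => ?_⟩
  · refine ⟨esymmOn n Finset.univ (n - k) * f, ?_, rfl⟩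
    rw [add_comm]
    exact (esymmOn_isHomogeneous n Finset.univ (n - k)).mul hf
  · rw [map_mul (MvPolynomial.rename σ), rename_esymmOn_univ]
    rfl

end PackedWords
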